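/- arXiv:2303.00110 — 7 statements merged into one kernel-verified Lean document; each statement's English description precedes it below -/
import Mathlib

section
/- Let Π₁ = (V₁, R₁) and Π₂ = (V₂, R₂) be Boolean P systems and let Π₁ ∪ Π₂ = (V₁ ∪ V₂, R₁ ∪ R₂) be their union. Then for every configuration W ⊆ V₁ ∪ V₂, Appl(Π₁ ∪ Π₂, W) = Appl(Π₁, W) ⊗ Appl(Π₂, W), where A ⊗ B = { a ∪ b | a ∈ A, b ∈ B } for sets of sets A and B. -/
/-- A rule `A → B | φ` of a Boolean P system: a left-hand side `A ⊆ V`,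
a right-hand side `B ⊆ V`, and a guard `φ`, a predicate on subsets of `V`. -/
structure BRule (σ : Type*) where
  lhs : Set σ
  rhs : Set σ
  guard : Set σ → Prop

/-- A rule `A → B | φ` is applicable to a configuration `W` iff `A ⊆ W` and `φ(W)` holds. -/
def BRule.applicable {σ : Type*} (r : BRule σ) (W : Set σ) : Prop :=
  r.lhs ⊆ W ∧ r.guard W

/-- `Appl R W` : the set of all subsets of the rule set `R` each of whose
rules is applicable to `W`. -/
def Appl {σ : Type*} (R : Set (BRule σ)) (W : Set σ) : Set (Set (BRule σ)) :=
  {m | m ⊆ R ∧ ∀ r ∈ m, r.applicable W}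

/-- Applying a set of (individually applicable) rules `{Aᵢ → Bᵢ | φᵢ}` to `W`
yields `(W \ ⋃ᵢ Aᵢ) ∪ ⋃ᵢ Bᵢ`. -/
def applyRules {σ : Type*} (m : Set (BRule σ)) (W : Set σ) : Set σ :=
  (W \ ⋃ r ∈ m, BRule.lhs r) ∪ ⋃ r ∈ m, BRule.rhs r

/-- Applying a set of rules to `W`, where exactly those rules of the set that
are applicable to `W` are applied. -/
def applyAppl {σ : Type*} (m : Set (BRule σ)) (W : Set σ) : Set σ :=
  applyRules {r ∈ m | r.applicable W} W

/-- `A ⊗ B = { a ∪ b | a ∈ A, b ∈ B }` for sets of sets. -/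
def otimes {α : Type*} (A B : Set (Set α)) : Set (Set α) :=
  {c | ∃ a ∈ A, ∃ b ∈ B, c = a ∪ b}

/-- One evolution step of a Boolean P system under a quasimode `Mt`: choose a
set of rules `m ∈ Mt` and apply all of its rules applicable to the current
configuration. -/
def QStep {σ : Type*} (Mt : Set (Set (BRule σ))) (W W' : Set σ) : Prop :=
  ∃ m ∈ Mt, W' = applyAppl m W

/-- A Boolean P system `Π = (V, R)`: an alphabet `V` and a set of rules `R`. -/
structure BPSys (σ : Type*) where
  alphabet : Set σ
  rules : Set (BRule σ)

/-- The union of two Boolean P systems: `Π₁ ∪ Π₂ = (V₁ ∪ V₂, R₁ ∪ R₂)`. -/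
def BPSys.union {σ : Type*} (P₁ P₂ : BPSys σ) : BPSys σ :=
  ⟨P₁.alphabet ∪ P₂.alphabet, P₁.rules ∪ P₂.rules⟩

/-- for every configuration `W ⊆ V₁ ∪ V₂`,
`Appl(Π₁ ∪ Π₂, W) = Appl(Π₁, W) ⊗ Appl(Π₂, W)`. -/
theorem stmt0 {σ : Type*} [Finite σ] (P₁ P₂ : BPSys σ)
    (W : Set σ) (hW : W ⊆ (P₁.union P₂).alphabet) :
    Appl (P₁.union P₂).rules W = otimes (Appl P₁.rules W) (Appl P₂.rules W) := by
  ext m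
  constructor
  · rintro ⟨h1, h2⟩
    refine ⟨m ∩ P₁.rules, ⟨Set.inter_subset_right, fun r hr => h2 r hr.1⟩,
      m ∩ P₂.rules, ⟨Set.inter_subset_right, fun r hr => h2 r hr.1⟩, ?_⟩
    rw [← Set.inter_union_distrib_left]
    exact (Set.inter_eq_left.mpr h1).symm
  · rintro ⟨a, ⟨ha1, ha2⟩, b, ⟨hb1, hb2⟩, rfl⟩
    exact ⟨Set.union_subset_union ha1 hb1, fun r hr => hr.elim (ha2 r) (hb2 r)⟩
end

section
/- Let Π₁ = (V₁, R₁) and Π₂ = (V₂, R₂) be Boolean P systems with union Π = Π₁ ∪ Π₂, let M₁ be the mode derived from a quasimode M̃₁ ⊆ 2^{R₁} and M₂ the mode derived from a quasimode M̃₂ ⊆ 2^{R₂}. Then the mode derived from the quasimode M̃₁ ⊗ M̃₂ equals the product mode M₁ × M₂, i.e. for every W ⊆ V₁ ∪ V₂, (M̃₁ ⊗ M̃₂) ∩ Appl(Π, W) = (M̃₁ ∩ Appl(Π, W)) ⊗ (M̃₂ ∩ Appl(Π, W)) = M₁(W) ⊗ M₂(W). -/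
/-- for Boolean P systems `Π₁ = (V₁, R₁)`, `Π₂ = (V₂, R₂)` with union
`Π = (V₁ ∪ V₂, R₁ ∪ R₂)`, and quasimodes `M̃₁ ⊆ 2^{R₁}`, `M̃₂ ⊆ 2^{R₂}`, the mode
derived from `M̃₁ ⊗ M̃₂` equals the product mode `M₁ × M₂`: for every `W ⊆ V₁ ∪ V₂`,
`(M̃₁ ⊗ M̃₂) ∩ Appl(Π, W) = (M̃₁ ∩ Appl(Π, W)) ⊗ (M̃₂ ∩ Appl(Π, W)) = M₁(W) ⊗ M₂(W)`,
where `M₁(W) = M̃₁ ∩ Appl(Π₁, W)` and `M₂(W) = M̃₂ ∩ Appl(Π₂, W)`. -/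
theorem stmt1 {σ : Type*} [Finite σ] (V₁ V₂ : Set σ) (R₁ R₂ : Set (BRule σ))
    (Mt₁ Mt₂ : Set (Set (BRule σ)))
    (hMt₁ : ∀ m ∈ Mt₁, m ⊆ R₁) (hMt₂ : ∀ m ∈ Mt₂, m ⊆ R₂)
    (W : Set σ) (hW : W ⊆ V₁ ∪ V₂) :
    otimes Mt₁ Mt₂ ∩ Appl (R₁ ∪ R₂) W
      = otimes (Mt₁ ∩ Appl (R₁ ∪ R₂) W) (Mt₂ ∩ Appl (R₁ ∪ R₂) W)
    ∧ otimes (Mt₁ ∩ Appl (R₁ ∪ R₂) W) (Mt₂ ∩ Appl (R₁ ∪ R₂) W)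
      = otimes (Mt₁ ∩ Appl R₁ W) (Mt₂ ∩ Appl R₂ W) := by
  have h1 : Mt₁ ∩ Appl (R₁ ∪ R₂) W = Mt₁ ∩ Appl R₁ W := by
    ext m
    constructor
    · rintro ⟨h, _, h'⟩
      exact ⟨h, hMt₁ m h, h'⟩
    · rintro ⟨h, _, h'⟩
      exact ⟨h, (hMt₁ m h).trans Set.subset_union_left, h'⟩
  have h2 : Mt₂ ∩ Appl (R₁ ∪ R₂) W = Mt₂ ∩ Appl R₂ W := by
    ext m
    constructor
    · rintro ⟨h, _, h'⟩
      exact ⟨h, hMt₂ m h, h'⟩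
    · rintro ⟨h, _, h'⟩
      exact ⟨h, (hMt₂ m h).trans Set.subset_union_right, h'⟩
  refine ⟨?_, by rw [h1, h2]⟩
  ext c
  constructor
  · rintro ⟨⟨a, ha, b, hb, rfl⟩, hs, hc⟩
    exact ⟨a, ⟨ha, Set.subset_union_left.trans hs, fun r hr => hc r (Or.inl hr)⟩,
      b, ⟨hb, Set.subset_union_right.trans hs, fun r hr => hc r (Or.inr hr)⟩, rfl⟩
  · rintro ⟨a, ⟨ha, hsa, hca⟩, b, ⟨hb, hsb, hcb⟩, rfl⟩
    exact ⟨⟨a, ha, b, hb, rfl⟩, Set.union_subset hsa hsb,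
      fun r hr => hr.elim (hca r) (hcb r)⟩
end

section
/- Let F be a Boolean network over a finite set X of variables and let s, s' : X → {0,1} be states with corresponding subsets W, W' ⊆ X (indicator functions). For any m ⊆ X, the following are equivalent: (1) s' is obtained from s by the one-step update of F on exactly the variables in m (i.e. s'(x) = F(s)(x) for x ∈ m and s'(x) = s(x) for x ∉ m); (2) W' is obtained from W by applying the set of rules ⋃_{x ∈ m} R_x of the Boolean P system Π(F), where each rule applicable to W is applied. -/
/-- The rule `∅ → {x} | f_x` of `Π(F)`, where `f_x(s) = F(s)(x)` (states are
identified with subsets of `X`). -/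
def ruleOn {X : Type*} (F : Set X → Set X) (x : X) : BRule X :=
  ⟨∅, {x}, fun W => x ∈ F W⟩

/-- The rule `{x} → ∅ | ¬f_x` of `Π(F)`. -/
def ruleOff {X : Type*} (F : Set X → Set X) (x : X) : BRule X :=
  ⟨{x}, ∅, fun W => x ∉ F W⟩

/-- `R_x = { ∅ → {x} | f_x, {x} → ∅ | ¬f_x }`. -/
def Rx {X : Type*} (F : Set X → Set X) (x : X) : Set (BRule X) :=
  {ruleOn F x, ruleOff F x}

theorem mem_applyAppl_aux {X : Type*} (F : Set X → Set X) (m W : Set X) (x : X) :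
    x ∈ applyAppl (⋃ x ∈ m, Rx F x) W ↔ (x ∈ m ∧ x ∈ F W) ∨ (x ∉ m ∧ x ∈ W) := by
  have h1 : (∃ r, (r ∈ (⋃ x ∈ m, Rx F x) ∧ r.applicable W) ∧ x ∈ r.lhs) ↔
      x ∈ m ∧ x ∈ W ∧ x ∉ F W := by
    constructor
    · rintro ⟨r, ⟨hr, ha⟩, hx⟩
      simp only [Set.mem_iUnion] at hr
      obtain ⟨y, hy, rfl | rfl⟩ := hr
      · exact absurd hx (Set.notMem_empty x)
      · obtain rfl : x = y := hx
        exact ⟨hy, ha.1 rfl, ha.2⟩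
    · rintro ⟨hm, hW, hF⟩
      refine ⟨ruleOff F x, ⟨?_, Set.singleton_subset_iff.2 hW, hF⟩, rfl⟩
      exact Set.mem_biUnion hm (Or.inr rfl)
  have h2 : (∃ r, (r ∈ (⋃ x ∈ m, Rx F x) ∧ r.applicable W) ∧ x ∈ r.rhs) ↔
      x ∈ m ∧ x ∈ F W := by
    constructor
    · rintro ⟨r, ⟨hr, ha⟩, hx⟩
      simp only [Set.mem_iUnion] at hr
      obtain ⟨y, hy, rfl | rfl⟩ := hr
      · obtain rfl : x = y := hx
        exact ⟨hy, ha.2⟩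
      · exact absurd hx (Set.notMem_empty x)
    · rintro ⟨hm, hF⟩
      refine ⟨ruleOn F x, ⟨?_, Set.empty_subset _, hF⟩, rfl⟩
      exact Set.mem_biUnion hm (Or.inl rfl)
  have h3 : x ∈ applyAppl (⋃ x ∈ m, Rx F x) W ↔
      (x ∈ W ∧ ¬ (∃ r, (r ∈ (⋃ x ∈ m, Rx F x) ∧ r.applicable W) ∧ x ∈ r.lhs)) ∨
      (∃ r, (r ∈ (⋃ x ∈ m, Rx F x) ∧ r.applicable W) ∧ x ∈ r.rhs) := by
    unfold applyAppl applyRules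
    rw [Set.mem_union, Set.mem_diff, Set.mem_iUnion₂, Set.mem_iUnion₂]
    simp only [Set.mem_setOf_eq, exists_prop]
  rw [h3, h1, h2]
  tauto

/-- for a Boolean network `F` over `X`, states `s, s'` identified with
subsets `W, W' ⊆ X`, and any `m ⊆ X`: `s'` is obtained from `s` by the one-step
update of `F` on exactly the variables of `m` (i.e. `s'(x) = F(s)(x)` for `x ∈ m`
and `s'(x) = s(x)` for `x ∉ m`) iff `W'` is obtained from `W` by applying the set
of rules `⋃_{x ∈ m} R_x` of `Π(F)` (each rule applicable to `W` being applied). -/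
theorem stmt2 {X : Type*} [Finite X] (F : Set X → Set X) (m W W' : Set X) :
    ((∀ x ∈ m, (x ∈ W' ↔ x ∈ F W)) ∧ (∀ x ∉ m, (x ∈ W' ↔ x ∈ W)))
      ↔ W' = applyAppl (⋃ x ∈ m, Rx F x) W := by
  rw [Set.ext_iff]
  simp only [mem_applyAppl_aux]
  constructor
  · rintro ⟨h1, h2⟩ x
    have := h1 x
    have := h2 x
    tauto
  · intro h
    refine ⟨fun x hx => ?_, fun x hx => ?_⟩
    · have := h x
      tauto
    · have := h x
      tauto
end

section
/- Let F_U be a Boolean control network with variables X and control inputs U, and let s, s' : X → {0,1} be states and μ ⊆ U a control, with corresponding subsets W, W' ⊆ X and W_μ ⊆ U. For any m ⊆ X: F_U(μ) derives s' from s in one step by updating exactly the variables in m if and only if the Boolean P system Π = (X ∪ U, ⋃_{x∈X} R_x) derives W' ∪ W_μ from W ∪ W_μ by applying the set of rules ⋃_{x∈m} R_x (each rule applicable to W ∪ W_μ being applied). -/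
/-- The state part of a configuration over the alphabet `X ∪ U` (disjoint union). -/
def stateOf {X U : Type*} (W : Set (X ⊕ U)) : Set X := {x | Sum.inl x ∈ W}

/-- The control part of a configuration over the alphabet `X ∪ U`. -/
def ctrlOf {X U : Type*} (W : Set (X ⊕ U)) : Set U := {u | Sum.inr u ∈ W}

/-- The configuration `W ∪ W_μ` over `X ∪ U` corresponding to a state `s ⊆ X`
together with a control `μ ⊆ U`. -/
def embedSC {X U : Type*} (s : Set X) (μ : Set U) : Set (X ⊕ U) :=
  Sum.inl '' s ∪ Sum.inr '' μ

/-- The rule `∅ → {x} | f'_x` where `f'_x(s, μ) = F_U(μ)(s)(x)`, viewed as a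
Boolean function over `X ∪ U`. -/
def ruleOn' {X U : Type*} (F : Set U → Set X → Set X) (x : X) : BRule (X ⊕ U) :=
  ⟨∅, {Sum.inl x}, fun W => x ∈ F (ctrlOf W) (stateOf W)⟩

/-- The rule `{x} → ∅ | ¬f'_x`. -/
def ruleOff' {X U : Type*} (F : Set U → Set X → Set X) (x : X) : BRule (X ⊕ U) :=
  ⟨{Sum.inl x}, ∅, fun W => x ∉ F (ctrlOf W) (stateOf W)⟩

/-- `R_x = { ∅ → {x} | f'_x, {x} → ∅ | ¬f'_x }` over the alphabet `X ∪ U`. -/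
def Rx' {X U : Type*} (F : Set U → Set X → Set X) (x : X) : Set (BRule (X ⊕ U)) :=
  {ruleOn' F x, ruleOff' F x}

/-- The quasimode `M̃ = { ⋃_{x∈m} R_x | m ∈ M }` of `Π = (X ∪ U, ⋃_{x∈X} R_x)`
corresponding to a Boolean mode `M ⊆ 2^X`. -/
def bcnQuasimode {X U : Type*} (F : Set U → Set X → Set X) (M : Set (Set X)) :
    Set (Set (BRule (X ⊕ U))) :=
  {a | ∃ m ∈ M, a = ⋃ x ∈ m, Rx' F x}

theorem mem_step_inl {X U : Type*} (F : Set U → Set X → Set X)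
    (m s : Set X) (μ : Set U) (x : X) :
    Sum.inl x ∈ applyAppl (⋃ x ∈ m, Rx' F x) (embedSC s μ) ↔
      (x ∈ m ∧ x ∈ F μ s) ∨ (x ∉ m ∧ x ∈ s) := by
  have hc : ctrlOf (embedSC s μ) = μ := by ext u; simp [ctrlOf, embedSC]
  have hs : stateOf (embedSC s μ) = s := by ext u; simp [stateOf, embedSC]
  have hx : ∀ y, (Sum.inl y : X ⊕ U) ∈ embedSC s μ ↔ y ∈ s := by intro y; simp [embedSC]
  have hon : ∀ y, (ruleOn' F y).applicable (embedSC s μ) ↔ y ∈ F μ s := by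
    intro y; simp [ruleOn', BRule.applicable, hc, hs]
  have hoff : ∀ y, (ruleOff' F y).applicable (embedSC s μ) ↔ y ∈ s ∧ y ∉ F μ s := by
    intro y; simp [ruleOff', BRule.applicable, hc, hs, hx]
  have hL : (Sum.inl x ∈ ⋃ r ∈ {r ∈ ⋃ x ∈ m, Rx' F x | r.applicable (embedSC s μ)},
      BRule.lhs r) ↔ x ∈ m ∧ x ∈ s ∧ x ∉ F μ s := by
    simp only [Set.mem_iUnion, Set.mem_setOf_eq, exists_prop]
    constructor
    · rintro ⟨r, ⟨⟨y, hy, rfl | rfl⟩, ha⟩, h⟩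
      · simp [ruleOn'] at h
      · have : x = y := by simpa [ruleOff'] using h
        subst this
        exact ⟨hy, (hoff x).1 ha⟩
    · rintro ⟨h1, h2⟩
      exact ⟨ruleOff' F x, ⟨⟨x, h1, Or.inr rfl⟩, (hoff x).2 h2⟩, rfl⟩
  have hR : (Sum.inl x ∈ ⋃ r ∈ {r ∈ ⋃ x ∈ m, Rx' F x | r.applicable (embedSC s μ)},
      BRule.rhs r) ↔ x ∈ m ∧ x ∈ F μ s := by
    simp only [Set.mem_iUnion, Set.mem_setOf_eq, exists_prop]
    constructor
    · rintro ⟨r, ⟨⟨y, hy, rfl | rfl⟩, ha⟩, h⟩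
      · have : x = y := by simpa [ruleOn'] using h
        subst this
        exact ⟨hy, (hon x).1 ha⟩
      · simp [ruleOff'] at h
    · rintro ⟨h1, h2⟩
      exact ⟨ruleOn' F x, ⟨⟨x, h1, Or.inl rfl⟩, (hon x).2 h2⟩, rfl⟩
  unfold applyAppl applyRules
  rw [Set.mem_union, Set.mem_sdiff, hL, hR, hx]
  tauto

theorem mem_step_inr {X U : Type*} (F : Set U → Set X → Set X)
    (m s : Set X) (μ : Set U) (u : U) :
    Sum.inr u ∈ applyAppl (⋃ x ∈ m, Rx' F x) (embedSC s μ) ↔ u ∈ μ := by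
  have hL : (Sum.inr u ∉ ⋃ r ∈ {r ∈ ⋃ x ∈ m, Rx' F x | r.applicable (embedSC s μ)},
      BRule.lhs r) := by
    simp only [Set.mem_iUnion, Set.mem_setOf_eq, exists_prop]
    rintro ⟨r, ⟨⟨y, hy, rfl | rfl⟩, ha⟩, h⟩ <;> simp [ruleOn', ruleOff'] at h
  have hR : (Sum.inr u ∉ ⋃ r ∈ {r ∈ ⋃ x ∈ m, Rx' F x | r.applicable (embedSC s μ)},
      BRule.rhs r) := by
    simp only [Set.mem_iUnion, Set.mem_setOf_eq, exists_prop]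
    rintro ⟨r, ⟨⟨y, hy, rfl | rfl⟩, ha⟩, h⟩ <;> simp [ruleOn', ruleOff'] at h
  have hx : (Sum.inr u : X ⊕ U) ∈ embedSC s μ ↔ u ∈ μ := by simp [embedSC]
  unfold applyAppl applyRules
  rw [Set.mem_union, Set.mem_sdiff, hx]
  tauto

/-- for a BCN `F_U`, states `s, s'`, control `μ` and any `m ⊆ X`:
`F_U(μ)` derives `s'` from `s` in one step by updating exactly the variables in `m`
iff the Boolean P system `Π = (X ∪ U, ⋃_{x∈X} R_x)` derives `W' ∪ W_μ` from
`W ∪ W_μ` by applying the set of rules `⋃_{x∈m} R_x` (each rule applicable to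
`W ∪ W_μ` being applied). -/
theorem stmt4 {X U : Type*} [Finite X] [Finite U] (F : Set U → Set X → Set X)
    (m s s' : Set X) (μ : Set U) :
    ((∀ x ∈ m, (x ∈ s' ↔ x ∈ F μ s)) ∧ (∀ x ∉ m, (x ∈ s' ↔ x ∈ s)))
      ↔ applyAppl (⋃ x ∈ m, Rx' F x) (embedSC s μ) = embedSC s' μ := by
  have hx : ∀ y, (Sum.inl y : X ⊕ U) ∈ embedSC s' μ ↔ y ∈ s' := by intro y; simp [embedSC]
  have hu : ∀ u, (Sum.inr u : X ⊕ U) ∈ embedSC s' μ ↔ u ∈ μ := by intro y; simp [embedSC]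
  constructor
  · rintro ⟨h1, h2⟩
    ext (x | u)
    · rw [mem_step_inl, hx]
      have := h1 x
      have := h2 x
      tauto
    · rw [mem_step_inr, hu]
  · intro h
    have key : ∀ x, ((x ∈ m ∧ x ∈ F μ s) ∨ (x ∉ m ∧ x ∈ s)) ↔ x ∈ s' := by
      intro x
      rw [← mem_step_inl, h, hx]
    constructor <;> intro x hm <;> have := key x <;> tauto
end

section
/- Let F_U be a Boolean control network with variables X and control inputs U running under a Boolean mode M ⊆ 2^X. For any evolution of the composite Boolean P system Π ∪ Π_U under the quasimode M̃ ⊗ M̃_U there exists an equivalent controlled trajectory of F_U under M: translating each configuration W ∪ W_U (W ⊆ X, W_U ⊆ U) of the evolution into the state corresponding to W and the control corresponding to W_U yields a trajectory of F_U under a control sequence compatible with the evolution. -/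
/-- `R_U^0 = { {u} → ∅ | ⊤ : u ∈ U }` over the alphabet `X ∪ U`. -/
def RU0 (X U : Type*) : Set (BRule (X ⊕ U)) :=
  {r | ∃ u : U, r = ⟨{Sum.inr u}, ∅, fun _ => True⟩}

/-- `R_U^1 = { ∅ → {u} | ⊤ : u ∈ U }` over the alphabet `X ∪ U`. -/
def RU1 (X U : Type*) : Set (BRule (X ⊕ U)) :=
  {r | ∃ u : U, r = ⟨∅, {Sum.inr u}, fun _ => True⟩}

/-- The quasimode `M̃_U = { R_U^0 ∪ m | m ⊆ R_U^1 }` of `Π_U`. -/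
def MtU (X U : Type*) : Set (Set (BRule (X ⊕ U))) :=
  {b | ∃ m ⊆ RU1 X U, b = RU0 X U ∪ m}

/-- for any evolution of the composite Boolean P system `Π ∪ Π_U`
under the quasimode `M̃ ⊗ M̃_U`, translating each configuration `W ∪ W_U`
(`W ⊆ X`, `W_U ⊆ U`) into the state corresponding to `W` and the control
corresponding to `W_U` yields a controlled trajectory of `F_U` under the mode `M`:
every step of the evolution projects to a one-step update of `F_U` under the
control present in the current configuration and some `m ∈ M`. -/
theorem stmt6 {X U : Type*} [Finite X] [Finite U]
    (F : Set U → Set X → Set X) (M : Set (Set X))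
    (L : ℕ) (W : ℕ → Set (X ⊕ U))
    (hev : ∀ j < L, QStep (otimes (bcnQuasimode F M) (MtU X U)) (W j) (W (j + 1))) :
    ∀ j < L, ∃ m ∈ M,
      stateOf (W (j + 1))
        = (F (ctrlOf (W j)) (stateOf (W j)) ∩ m) ∪ (stateOf (W j) \ m) := by
  intro j hj
  obtain ⟨c, ⟨a, ⟨m, hm, rfl⟩, b, ⟨n, hn, rfl⟩, rfl⟩, hW⟩ := hev j hj
  refine ⟨m, hm, ?_⟩
  rw [hW]
  generalize W j = V
  have hl : ∀ x : X, (∃ r, (r ∈ ((⋃ x ∈ m, Rx' F x) ∪ (RU0 X U ∪ n)) ∧ r.applicable V) ∧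
      Sum.inl x ∈ r.lhs) ↔ (x ∈ m ∧ Sum.inl x ∈ V ∧ x ∉ F (ctrlOf V) (stateOf V)) := by
    intro x
    constructor
    · rintro ⟨r, ⟨hr | hr | hr, ha⟩, hx⟩
      · simp only [Set.mem_iUnion] at hr
        obtain ⟨y, hy, rfl | rfl⟩ := hr
        · simp [ruleOn'] at hx
        · simp only [ruleOff', Set.mem_singleton_iff, Sum.inl.injEq] at hx
          subst hx
          exact ⟨hy, ha.1 rfl, ha.2⟩
      · obtain ⟨u, rfl⟩ := hr
        simp at hx
      · obtain ⟨u, rfl⟩ := hn hr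
        simp at hx
    · rintro ⟨h1, h2, h3⟩
      refine ⟨ruleOff' F x, ⟨Or.inl ?_, ?_, h3⟩, rfl⟩
      · simp only [Set.mem_iUnion]
        exact ⟨x, h1, Or.inr rfl⟩
      · simpa [ruleOff'] using h2
  have hr : ∀ x : X, (∃ r, (r ∈ ((⋃ x ∈ m, Rx' F x) ∪ (RU0 X U ∪ n)) ∧ r.applicable V) ∧
      Sum.inl x ∈ r.rhs) ↔ (x ∈ m ∧ x ∈ F (ctrlOf V) (stateOf V)) := by
    intro x
    constructor
    · rintro ⟨r, ⟨hr | hr | hr, ha⟩, hx⟩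
      · simp only [Set.mem_iUnion] at hr
        obtain ⟨y, hy, rfl | rfl⟩ := hr
        · simp only [ruleOn', Set.mem_singleton_iff, Sum.inl.injEq] at hx
          subst hx
          exact ⟨hy, ha.2⟩
        · simp [ruleOff'] at hx
      · obtain ⟨u, rfl⟩ := hr
        simp at hx
      · obtain ⟨u, rfl⟩ := hn hr
        simp at hx
    · rintro ⟨h1, h3⟩
      refine ⟨ruleOn' F x, ⟨Or.inl ?_, ?_, h3⟩, rfl⟩
      · simp only [Set.mem_iUnion]
        exact ⟨x, h1, Or.inl rfl⟩
      · simp [ruleOn']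
  ext x
  have e : x ∈ stateOf (applyAppl ((⋃ x ∈ m, Rx' F x) ∪ (RU0 X U ∪ n)) V) ↔
      ((Sum.inl x ∈ V ∧ ¬ (x ∈ m ∧ Sum.inl x ∈ V ∧ x ∉ F (ctrlOf V) (stateOf V))) ∨
        (x ∈ m ∧ x ∈ F (ctrlOf V) (stateOf V))) := by
    rw [← hl x, ← hr x]
    simp only [stateOf, applyAppl, applyRules, Set.mem_setOf_eq, Set.mem_union, Set.mem_sdiff,
      Set.mem_iUnion, exists_prop]
  rw [e]
  have hs : x ∈ stateOf V ↔ Sum.inl x ∈ V := Iff.rfl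
  simp only [Set.mem_union, Set.mem_inter_iff, Set.mem_sdiff, hs]
  tauto
end

section
/- Let 𝓐 be a reaction system over a finite set S of species, consisting of reactions a = (R_a, I_a, P_a) with R_a, I_a, P_a ⊆ S. Construct the Boolean P system Π_𝓐 = (S, R) whose rules are: for each reaction a, the rule ∅ → P_a | φ_a where φ_a(W) holds iff R_a ⊆ W and I_a ∩ W = ∅; and for each species x ∈ S, the degradation rule {x} → ∅ | ⊤. Then for every configuration W ⊆ S, one step of Π_𝓐 under the quasimode consisting of the single set of all rules yields exactly the result of 𝓐 on W, namely the union of the product sets P_a over all reactions a enabled on W (those with R_a ⊆ W and I_a ∩ W = ∅). -/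
/-- A reaction `a = (R_a, I_a, P_a)` of a reaction system over a set `S` of
species: reactants, inhibitors and products. -/
structure Reaction (σ : Type*) where
  reactants : Set σ
  inhibitors : Set σ
  products : Set σ

/-- A reaction is enabled on `W` iff `R_a ⊆ W` and `I_a ∩ W = ∅`. -/
def Reaction.enabled {σ : Type*} (a : Reaction σ) (W : Set σ) : Prop :=
  a.reactants ⊆ W ∧ a.inhibitors ∩ W = ∅

/-- The rules of the Boolean P system `Π_𝓐 = (S, R)`: a rule `∅ → P_a | φ_a`
for each reaction `a` (with `φ_a(W)` iff `a` is enabled on `W`), and a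
degradation rule `{x} → ∅ | ⊤` for each species `x ∈ S`. -/
def rsRules {σ : Type*} (RS : Set (Reaction σ)) : Set (BRule σ) :=
  {r | ∃ a ∈ RS, r = ⟨∅, a.products, fun W => a.enabled W⟩} ∪
  {r | ∃ x : σ, r = ⟨{x}, ∅, fun _ => True⟩}

/-- for every configuration `W ⊆ S`, one step of `Π_𝓐` under the
quasimode consisting of the single set of all rules (i.e. applying all rules
applicable to `W`) yields exactly the result of the reaction system `𝓐` on `W`:
the union of the product sets `P_a` over all reactions `a` enabled on `W`. -/
theorem stmt13 {σ : Type*} [Finite σ] (RS : Set (Reaction σ)) (W : Set σ) :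
    applyAppl (rsRules RS) W
      = ⋃ a ∈ {a ∈ RS | a.enabled W}, Reaction.products a := by
  ext y
  simp only [applyAppl, applyRules, Set.mem_union, Set.mem_diff, Set.mem_iUnion, Set.mem_setOf_eq,
    exists_prop]
  constructor
  · rintro (⟨hW, hn⟩ | ⟨r, ⟨hr, happ⟩, hy⟩)
    · exact absurd ⟨⟨{y}, ∅, fun _ => True⟩, ⟨Or.inr ⟨y, rfl⟩,
        Set.singleton_subset_iff.2 hW, trivial⟩, rfl⟩ hn
    · rcases hr with ⟨a, ha, rfl⟩ | ⟨x, rfl⟩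
      · exact ⟨a, ⟨ha, happ.2⟩, hy⟩
      · exact absurd hy (Set.notMem_empty y)
  · rintro ⟨a, ⟨ha, hen⟩, hy⟩
    exact Or.inr ⟨⟨∅, a.products, fun W => a.enabled W⟩,
      ⟨Or.inl ⟨a, ha, rfl⟩, Set.empty_subset W, hen⟩, hy⟩
end

section
/- Let Π₁ = (V₁, R₁) and Π₂ = (V₂, R₂) be Boolean P systems with disjoint alphabets V₁ ∩ V₂ = ∅, whose guards are predicates depending only on the symbols of their own alphabets, and let M₁ and M₂ be modes of Π₁ and Π₂ respectively. Then for any evolution (Wᵢ)_{0≤i≤k} of the union Π₁ ∪ Π₂ under the product mode M₁ × M₂, the projected sequence (Wᵢ ∩ V₁)_{0≤i≤k} is an evolution of Π₁ under M₁ (in which consecutive states may repeat), and symmetrically (Wᵢ ∩ V₂)_{0≤i≤k} is an evolution of Π₂ under M₂. -/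
theorem stmt15_aux {σ : Type*} (V₁ V₂ : Set σ)
    (hd : ∀ x, x ∈ V₁ → x ∈ V₂ → False) (a b : Set (BRule σ))
    (ha : ∀ r ∈ a, r.rhs ⊆ V₁) (hb : ∀ r ∈ b, r.lhs ⊆ V₂)
    (hb' : ∀ r ∈ b, r.rhs ⊆ V₂) (W : Set σ) :
    applyRules (a ∪ b) W ∩ V₁ = applyRules a (W ∩ V₁) := by
  ext x
  simp only [applyRules, Set.mem_inter_iff, Set.mem_union, Set.mem_diff, Set.mem_iUnion,
    exists_prop, not_exists, not_and]
  constructor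
  · rintro ⟨⟨hW, hn⟩ | ⟨r, hr | hr, hx⟩, hV⟩
    · exact Or.inl ⟨⟨hW, hV⟩, fun r hr => hn r (Or.inl hr)⟩
    · exact Or.inr ⟨r, hr, hx⟩
    · exact (hd x hV (hb' r hr hx)).elim
  · rintro (⟨⟨hW, hV⟩, hn⟩ | ⟨r, hr, hx⟩)
    · refine ⟨Or.inl ⟨hW, ?_⟩, hV⟩
      rintro r (hr | hr) hx
      · exact hn r hr hx
      · exact hd x hV (hb r hr hx)
    · exact ⟨Or.inr ⟨r, Or.inl hr, hx⟩, ha r hr hx⟩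

/-- let `Π₁ = (V₁, R₁)` and `Π₂ = (V₂, R₂)` be Boolean P systems
with disjoint alphabets whose rules live over their own alphabets and whose
guards depend only on the symbols of their own alphabets, and let `M₁`, `M₂` be
modes of `Π₁`, `Π₂` (functions assigning to each configuration a set of sets of
applicable rules).  Then for any evolution `(Wᵢ)_{0≤i≤k}` of `Π₁ ∪ Π₂` under the
product mode `(M₁ × M₂)(W) = M₁(W ∩ V₁) ⊗ M₂(W ∩ V₂)`, the projection
`(Wᵢ ∩ V₁)` is an evolution of `Π₁` under `M₁` (in which consecutive states may
repeat), and symmetrically `(Wᵢ ∩ V₂)` is an evolution of `Π₂` under `M₂`. -/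
theorem stmt15 {σ : Type*} [Finite σ] (V₁ V₂ : Set σ)
    (R₁ R₂ : Set (BRule σ)) (hdisj : V₁ ∩ V₂ = ∅)
    (hR₁ : ∀ r ∈ R₁, r.lhs ⊆ V₁ ∧ r.rhs ⊆ V₁ ∧
      ∀ W W' : Set σ, W ∩ V₁ = W' ∩ V₁ → (r.guard W ↔ r.guard W'))
    (hR₂ : ∀ r ∈ R₂, r.lhs ⊆ V₂ ∧ r.rhs ⊆ V₂ ∧
      ∀ W W' : Set σ, W ∩ V₂ = W' ∩ V₂ → (r.guard W ↔ r.guard W'))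
    (M₁ M₂ : Set σ → Set (Set (BRule σ)))
    (hM₁ : ∀ W, M₁ W ⊆ Appl R₁ W) (hM₂ : ∀ W, M₂ W ⊆ Appl R₂ W)
    (k : ℕ) (Wseq : ℕ → Set σ) (hW0 : Wseq 0 ⊆ V₁ ∪ V₂)
    (hev : ∀ i < k, ∃ m ∈ otimes (M₁ (Wseq i ∩ V₁)) (M₂ (Wseq i ∩ V₂)),
      Wseq (i + 1) = applyRules m (Wseq i)) :
    (∀ i < k, ∃ m ∈ M₁ (Wseq i ∩ V₁),
        Wseq (i + 1) ∩ V₁ = applyRules m (Wseq i ∩ V₁)) ∧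
    (∀ i < k, ∃ m ∈ M₂ (Wseq i ∩ V₂),
        Wseq (i + 1) ∩ V₂ = applyRules m (Wseq i ∩ V₂)) := by
  have hd : ∀ x, x ∈ V₁ → x ∈ V₂ → False := fun x h1 h2 => by
    have : x ∈ V₁ ∩ V₂ := ⟨h1, h2⟩
    rw [hdisj] at this
    exact this
  constructor
  · intro i hi
    obtain ⟨m, ⟨a, ha, b, hb, rfl⟩, he⟩ := hev i hi
    refine ⟨a, ha, ?_⟩
    rw [he]
    exact stmt15_aux V₁ V₂ hd a b
      (fun r hr => (hR₁ r ((hM₁ _ ha).1 hr)).2.1)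
      (fun r hr => (hR₂ r ((hM₂ _ hb).1 hr)).1)
      (fun r hr => (hR₂ r ((hM₂ _ hb).1 hr)).2.1) _
  · intro i hi
    obtain ⟨m, ⟨a, ha, b, hb, rfl⟩, he⟩ := hev i hi
    refine ⟨b, hb, ?_⟩
    rw [he, Set.union_comm a b]
    exact stmt15_aux V₂ V₁ (fun x h1 h2 => hd x h2 h1) b a
      (fun r hr => (hR₂ r ((hM₂ _ hb).1 hr)).2.1)
      (fun r hr => (hR₁ r ((hM₁ _ ha).1 hr)).1)
      (fun r hr => (hR₁ r ((hM₁ _ ha).1 hr)).2.1) _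
end
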